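/- arXiv:2403.16302 — 2 statements merged into one kernel-verified Lean document; each statement's English description precedes it below -/
import Mathlib

section
/- Let x_0 be a Gaussian mixture random vector with components (α_i, μ_0^i, Σ_0^i), i = 1,…,K, and let μ_0^g = Σ_i α_i μ_0^i. Suppose the control is chosen as U = V + L^i (x_0 − μ_0^g), where, conditionally on x_0 = x̂, the index i is selected with probability λ_i(x̂) = α_i f_N(x̂; μ_0^i, Σ_0^i) / Σ_j α_j f_N(x̂; μ_0^j, Σ_0^j). Then U is distributed as the Gaussian mixture Σ_{i=1}^K α_i N(V + L^i(μ_0^i − μ_0^g), L^i Σ_0^i (L^i)^T). -/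
open MeasureTheory Matrix

/-- `ν` is a Gaussian measure on `ℝ^n` with mean `m` and covariance `S`. -/
def IsGaussian {n : ℕ} (ν : Measure (Fin n → ℝ)) (m : Fin n → ℝ)
    (S : Matrix (Fin n) (Fin n) ℝ) : Prop :=
  IsProbabilityMeasure ν ∧
    ∀ t : Fin n → ℝ,
      ν.map (fun x => t ⬝ᵥ x) =
        ProbabilityTheory.gaussianReal (t ⬝ᵥ m) (Real.toNNReal (t ⬝ᵥ S.mulVec t))

/-- The density `f_N(x; m, S)` of the multivariate normal `N(m, S)` on `ℝ^n`. -/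
noncomputable def gaussianPDF {n : ℕ} (m : Fin n → ℝ) (S : Matrix (Fin n) (Fin n) ℝ)
    (x : Fin n → ℝ) : ℝ :=
  (1 / Real.sqrt ((2 * Real.pi) ^ n * S.det)) *
    Real.exp (-(1 / 2) * ((x - m) ⬝ᵥ S⁻¹.mulVec (x - m)))

/-- Posterior kernel weights `λᵢ(xh) = αᵢ f_N(xh; μᵢ, Σᵢ) / ∑ⱼ αⱼ f_N(xh; μⱼ, Σⱼ)`. -/
noncomputable def lamWeight {n K : ℕ} (α : Fin K → ℝ) (μ : Fin K → (Fin n → ℝ))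
    (S : Fin K → Matrix (Fin n) (Fin n) ℝ) (i : Fin K) (x : Fin n → ℝ) : ℝ :=
  α i * gaussianPDF (μ i) (S i) x / ∑ j, α j * gaussianPDF (μ j) (S j) x


open scoped MatrixOrder in
lemma exists_factor {n : ℕ} {S : Matrix (Fin n) (Fin n) ℝ} (hS : S.PosDef) :
    ∃ A : Matrix (Fin n) (Fin n) ℝ, S = A * Aᵀ := by
  refine ⟨CFC.sqrt S, ?_⟩
  have h0 : (0 : Matrix (Fin n) (Fin n) ℝ) ≤ S := hS.posSemidef.nonneg
  have h1 : (CFC.sqrt S).PosSemidef := Matrix.nonneg_iff_posSemidef.1 (CFC.sqrt_nonneg S)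
  have h2 : (CFC.sqrt S)ᵀ = CFC.sqrt S := by
    have := h1.isHermitian.eq
    rwa [conjTranspose_eq_transpose_of_trivial] at this
  rw [h2, CFC.sqrt_mul_sqrt_self S h0]

lemma measurable_aff {n m : ℕ} (V : Fin m → ℝ) (L : Matrix (Fin m) (Fin n) ℝ) (g : Fin n → ℝ) :
    Measurable (fun x : Fin n → ℝ => V + L.mulVec (x - g)) := by
  apply Continuous.measurable
  fun_prop

lemma IsGaussian.aff {n m : ℕ} {ν : Measure (Fin n → ℝ)} {μ : Fin n → ℝ}
    {S : Matrix (Fin n) (Fin n) ℝ} (h : IsGaussian ν μ S)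
    (V : Fin m → ℝ) (L : Matrix (Fin m) (Fin n) ℝ) (g : Fin n → ℝ) :
    IsGaussian (ν.map (fun x => V + L.mulVec (x - g))) (V + L.mulVec (μ - g)) (L * S * Lᵀ) := by
  obtain ⟨hp, h⟩ := h
  refine ⟨Measure.isProbabilityMeasure_map (measurable_aff V L g).aemeasurable, fun t => ?_⟩
  have hm : ∀ k : ℕ, ∀ s : Fin k → ℝ, Measurable (fun x : Fin k → ℝ => s ⬝ᵥ x) := by
    intro k s
    apply Continuous.measurable
    fun_prop
  rw [Measure.map_map (hm _ t) (measurable_aff V L g)]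
  have e : ∀ x, t ⬝ᵥ (V + L.mulVec (x - g)) = (t ⬝ᵥ V - (Lᵀ.mulVec t) ⬝ᵥ g)
      + (Lᵀ.mulVec t) ⬝ᵥ x := by
    intro x
    rw [dotProduct_add, dotProduct_mulVec, ← mulVec_transpose, dotProduct_sub]
    ring
  have e2 : ((fun x => t ⬝ᵥ x) ∘ fun x => V + L.mulVec (x - g)) =
      (fun y : ℝ => (t ⬝ᵥ V - (Lᵀ.mulVec t) ⬝ᵥ g) + y) ∘ (fun x => (Lᵀ.mulVec t) ⬝ᵥ x) := by
    funext x
    exact e x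
  rw [e2, ← Measure.map_map (by fun_prop) (hm _ _), h,
    ProbabilityTheory.gaussianReal_map_const_add, e]
  congr 1
  · ring
  · rw [← mulVec_mulVec, ← mulVec_mulVec, dotProduct_mulVec t, ← mulVec_transpose]

lemma IsGaussian.ext {n : ℕ} {ν : Measure (Fin n → ℝ)}
    (h : IsGaussian ν 0 1) :
    ν = Measure.pi (fun _ => ProbabilityTheory.gaussianReal 0 1) := by
  obtain ⟨hp, h⟩ := h
  apply Measure.ext_of_charFunDual
  ext L
  rw [charFunDual_pi]
  have hL : (L : (Fin n → ℝ) → ℝ) = fun x => (fun i => L (Pi.single i 1)) ⬝ᵥ x := by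
    funext x
    rw [← L.sum_comp_single]
    simp only [dotProduct]
    refine Finset.sum_congr rfl fun i _ => ?_
    rw [ContinuousLinearMap.comp_apply, ContinuousLinearMap.single_apply]
    have : (Pi.single i (x i) : Fin n → ℝ) = x i • Pi.single i 1 := by
      rw [← Pi.single_smul]; simp
    rw [this, map_smul, smul_eq_mul, mul_comm]
  rw [charFunDual_eq_charFun_map_one, hL, h, ProbabilityTheory.charFun_gaussianReal]
  have hi : ∀ i, charFunDual (ProbabilityTheory.gaussianReal 0 1)
      (L.comp (.single ℝ (fun _ => ℝ) i)) = Complex.exp (-((L (Pi.single i 1) : ℝ) : ℂ) ^ 2 / 2) := by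
    intro i
    have hf : ((L.comp (.single ℝ (fun _ : Fin n => ℝ) i) : ℝ →L[ℝ] ℝ) : ℝ → ℝ) =
        fun y => L (Pi.single i 1) * y := by
      funext x
      rw [ContinuousLinearMap.comp_apply, ContinuousLinearMap.single_apply]
      have : (Pi.single i x : Fin n → ℝ) = x • Pi.single i 1 := by
        rw [← Pi.single_smul]; simp
      rw [this, map_smul, smul_eq_mul, mul_comm]
    rw [charFunDual_eq_charFun_map_one, hf, charFun_map_mul, 
      ProbabilityTheory.charFun_gaussianReal]
    simp [neg_div]
  rw [Finset.prod_congr rfl fun i _ => hi i, ← Complex.exp_sum]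
  congr 1
  have hnn : 0 ≤ ∑ i, L (Pi.single i 1) * L (Pi.single i 1) :=
    Finset.sum_nonneg fun i _ => mul_self_nonneg _
  simp only [one_mulVec, dotProduct]
  rw [Real.coe_toNNReal _ hnn]
  push_cast
  simp [Finset.sum_div, neg_div, sq]

lemma pdf_std {n : ℕ} (x : Fin n → ℝ) :
    gaussianPDF 0 1 x = ∏ i, ProbabilityTheory.gaussianPDFReal 0 1 (x i) := by
  unfold gaussianPDF
  simp only [ProbabilityTheory.gaussianPDFReal_def, Finset.prod_mul_distrib, ← Real.exp_sum]
  congr 1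
  · simp [Real.sqrt_eq_rpow, ← Real.rpow_natCast, ← Real.rpow_mul, Real.pi_pos.le, mul_comm]
  · simp only [dotProduct, Finset.mul_sum, sub_zero, inv_one, one_mulVec, NNReal.coe_one]
    congr 1
    refine Finset.sum_congr rfl fun i _ => ?_
    ring

lemma measurable_gpdf {n : ℕ} (μ : Fin n → ℝ) (S : Matrix (Fin n) (Fin n) ℝ) :
    Measurable (gaussianPDF μ S) := by
  unfold gaussianPDF
  apply Continuous.measurable
  fun_prop

lemma pi_std {n : ℕ} :
    Measure.pi (fun _ : Fin n => ProbabilityTheory.gaussianReal 0 1) =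
      volume.withDensity (fun x => ENNReal.ofReal (gaussianPDF 0 1 x)) := by
  refine Measure.pi_eq fun s hs => ?_
  have hbox : MeasurableSet (Set.univ.pi s) := MeasurableSet.univ_pi hs
  let f : Fin n → ℝ → ℝ := fun i => (s i).indicator (ProbabilityTheory.gaussianPDFReal 0 1)
  have hf0 : ∀ i y, 0 ≤ f i y := fun i y =>
    Set.indicator_nonneg (fun _ _ => ProbabilityTheory.gaussianPDFReal_nonneg _ _ _) _
  have hfi : ∀ i, Integrable (f i) volume := fun i =>
    (ProbabilityTheory.integrable_gaussianPDFReal 0 1).indicator (hs i)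
  rw [withDensity_apply _ hbox, ← lintegral_indicator hbox]
  have e : (fun x : Fin n → ℝ => (Set.univ.pi s).indicator
      (fun x => ENNReal.ofReal (gaussianPDF 0 1 x)) x) =
      fun x => ENNReal.ofReal (∏ i, f i (x i)) := by
    funext x
    by_cases hx : x ∈ Set.univ.pi s
    · rw [Set.indicator_of_mem hx, pdf_std]
      congr 1
      refine Finset.prod_congr rfl fun i _ => ?_
      exact (Set.indicator_of_mem (hx i (Set.mem_univ i)) _).symm
    · rw [Set.indicator_of_notMem hx]
      simp only [Set.mem_univ_pi, not_forall] at hx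
      obtain ⟨i, hi⟩ := hx
      rw [Finset.prod_eq_zero (Finset.mem_univ i) (Set.indicator_of_notMem hi _)]
      simp
  rw [e, ← ofReal_integral_eq_lintegral_ofReal]
  · rw [integral_fintype_prod_volume_eq_prod, ENNReal.ofReal_prod_of_nonneg
      (fun i _ => integral_nonneg (hf0 i))]
    refine Finset.prod_congr rfl fun i _ => ?_
    rw [ProbabilityTheory.gaussianReal_apply_eq_integral _ one_ne_zero, integral_indicator (hs i)]
  · exact Integrable.fintype_prod hfi
  · exact Filter.Eventually.of_forall fun x => Finset.prod_nonneg fun i _ => hf0 i _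

lemma IsGaussian.eq_withDensity {n : ℕ} {ν : Measure (Fin n → ℝ)} {μ : Fin n → ℝ}
    {S : Matrix (Fin n) (Fin n) ℝ} (hS : S.PosDef) (h : IsGaussian ν μ S) :
    ν = volume.withDensity (fun x => ENNReal.ofReal (gaussianPDF μ S x)) := by
  obtain ⟨A, hA⟩ := exists_factor hS
  have hdet : S.det = A.det ^ 2 := by rw [hA, det_mul, det_transpose, sq]
  have hA0 : A.det ≠ 0 := by
    intro h0
    have := hS.det_pos
    rw [hdet, h0] at this
    simp at this
  have hu : IsUnit A.det := hA0.isUnit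
  have hdi : (A⁻¹).det ≠ 0 := by
    rw [det_nonsing_inv, Ring.inverse_eq_inv']; exact inv_ne_zero hA0
  have hst := h.aff 0 A⁻¹ μ
  have e1 : A⁻¹ * S * (A⁻¹)ᵀ = 1 := by
    rw [hA, ← Matrix.mul_assoc, nonsing_inv_mul _ hu, Matrix.one_mul, ← transpose_mul,
      nonsing_inv_mul _ hu, transpose_one]
  rw [e1, sub_self, mulVec_zero, add_zero] at hst
  have hT := measurable_aff (0 : Fin n → ℝ) A⁻¹ μ
  set T : (Fin n → ℝ) → (Fin n → ℝ) := fun x => 0 + A⁻¹.mulVec (x - μ) with hTdef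
  have hT' := measurable_aff μ A (0 : Fin n → ℝ)
  set T' : (Fin n → ℝ) → (Fin n → ℝ) := fun x => μ + A.mulVec (x - 0) with hT'def
  have hTT : ∀ x, T' (T x) = x := by
    intro x
    simp [hTdef, hT'def, mulVec_mulVec, mul_nonsing_inv _ hu]
  have hlaw := hst.ext
  rw [pi_std] at hlaw
  have hvol : (volume : Measure (Fin n → ℝ)).map T = ENNReal.ofReal |A.det| • volume := by
    have : T = (toLin' A⁻¹) ∘ (fun x => x - μ) := by
      funext x; simp [hTdef]
    rw [this, ← Measure.map_map (LinearMap.continuous_on_pi _).measurable (by fun_prop),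
      (measurePreserving_sub_right volume μ).map_eq,
      Real.map_matrix_volume_pi_eq_smul_volume_pi hdi]
    congr 2
    rw [det_nonsing_inv, Ring.inverse_eq_inv', inv_inv]
  have hpdf : ∀ x, gaussianPDF 0 1 (T x) = |A.det| * gaussianPDF μ S x := by
    intro x
    unfold gaussianPDF
    have q : (T x - 0) ⬝ᵥ (1 : Matrix (Fin n) (Fin n) ℝ)⁻¹.mulVec (T x - 0) =
        (x - μ) ⬝ᵥ S⁻¹.mulVec (x - μ) := by
      rw [hA, Matrix.mul_inv_rev, ← mulVec_mulVec, dotProduct_mulVec (x - μ), ← mulVec_transpose,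
        transpose_nonsing_inv, transpose_transpose]
      simp [hTdef]
    rw [q, hdet, det_one, mul_one, Real.sqrt_mul (by positivity), Real.sqrt_sq_eq_abs]
    have : |A.det| ≠ 0 := abs_ne_zero.2 hA0
    field_simp
  have hd0 : ENNReal.ofReal |A.det| ≠ 0 := by
    simpa using hA0
  ext s hs
  have h1 : ν s = (ν.map T) (T' ⁻¹' s) := by
    rw [Measure.map_apply hT (hT' hs), ← Set.preimage_comp]
    congr 1
    ext x
    simp [hTT]
  have h2 : ENNReal.ofReal |A.det| * ν s = ENNReal.ofReal |A.det| *
      (volume.withDensity (fun x => ENNReal.ofReal (gaussianPDF μ S x))) s := by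
    rw [h1, hlaw, ← smul_eq_mul, ← Measure.smul_apply, ← withDensity_smul_measure, ← hvol,
      withDensity_apply _ (hT' hs), setLIntegral_map (hT' hs)
        (measurable_gpdf 0 1).ennreal_ofReal hT, ← Set.preimage_comp]
    have : T' ∘ T = id := funext hTT
    rw [this, Set.preimage_id, withDensity_apply _ hs,
      ← lintegral_const_mul _ (measurable_gpdf μ S).ennreal_ofReal]
    refine lintegral_congr fun x => ?_
    rw [hpdf, ENNReal.ofReal_mul (abs_nonneg _)]
  exact (ENNReal.mul_right_inj hd0 ENNReal.ofReal_ne_top).1 h2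

lemma pdf_pos {n : ℕ} (μ : Fin n → ℝ) {S : Matrix (Fin n) (Fin n) ℝ} (hS : S.PosDef)
    (x : Fin n → ℝ) : 0 < gaussianPDF μ S x := by
  have := hS.det_pos
  unfold gaussianPDF
  positivity

/-- Under the probabilistic affine policy `U = V + Lⁱ(x₀ − μ₀ᵍ)` (with the index `i` drawn
with posterior probability `λᵢ(x₀)`), the control `U` is distributed as the Gaussian
mixture `∑ᵢ αᵢ N(V + Lⁱ(μ₀ⁱ − μ₀ᵍ), Lⁱ Σ₀ⁱ (Lⁱ)ᵀ)`. -/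
theorem control_distribution {n m K : ℕ}
    (α : Fin K → ℝ) (hα : ∀ i, 0 < α i) (hαsum : ∑ i, α i = 1)
    (μ0 : Fin K → (Fin n → ℝ)) (S0 : Fin K → Matrix (Fin n) (Fin n) ℝ)
    (hS0 : ∀ i, (S0 i).PosDef)
    (ν : Fin K → Measure (Fin n → ℝ))
    (hν : ∀ i, IsGaussian (ν i) (μ0 i) (S0 i))
    (V : Fin m → ℝ) (L : Fin K → Matrix (Fin m) (Fin n) ℝ)
    (μ0g : Fin n → ℝ) (hμ0g : μ0g = ∑ i, α i • μ0 i) :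
    ∃ ρ : Fin K → Measure (Fin m → ℝ),
      (∀ i, IsGaussian (ρ i) (V + (L i).mulVec (μ0 i - μ0g)) (L i * S0 i * (L i)ᵀ)) ∧
      (∑ i, ENNReal.ofReal (α i) • ν i).bind
          (fun xh => ∑ i, ENNReal.ofReal (lamWeight α μ0 S0 i xh) •
            Measure.dirac (V + (L i).mulVec (xh - μ0g))) =
        ∑ i, ENNReal.ofReal (α i) • ρ i := by
  refine ⟨fun i => (ν i).map (fun x => V + (L i).mulVec (x - μ0g)),
    fun i => (hν i).aff V (L i) μ0g, ?_⟩
  have hpm : ∀ i, Measurable (gaussianPDF (μ0 i) (S0 i)) := fun i => measurable_gpdf _ _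
  have hlm : ∀ i, Measurable (lamWeight α μ0 S0 i) := by
    intro i
    unfold lamWeight
    fun_prop
  have hmix : (∑ i, ENNReal.ofReal (α i) • ν i) = volume.withDensity
      (fun x => ENNReal.ofReal (∑ j, α j * gaussianPDF (μ0 j) (S0 j) x)) := by
    ext s hs
    rw [withDensity_apply _ hs]
    have : ∀ x, ENNReal.ofReal (∑ j, α j * gaussianPDF (μ0 j) (S0 j) x) =
        ∑ j, ENNReal.ofReal (α j) * ENNReal.ofReal (gaussianPDF (μ0 j) (S0 j) x) := by
      intro x
      rw [ENNReal.ofReal_sum_of_nonneg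
        (fun j _ => (mul_pos (hα j) (pdf_pos (μ0 j) (hS0 j) x)).le)]
      exact Finset.sum_congr rfl fun j _ => ENNReal.ofReal_mul (hα j).le
    simp_rw [this]
    rw [lintegral_finsetSum _ (fun j _ => by fun_prop)]
    rw [Measure.finsetSum_apply]
    refine Finset.sum_congr rfl fun j _ => ?_
    rw [lintegral_const_mul _ (by fun_prop), Measure.smul_apply, smul_eq_mul,
      (hν j).eq_withDensity (hS0 j), withDensity_apply _ hs]
  have hker : Measurable (fun xh => ∑ i, ENNReal.ofReal (lamWeight α μ0 S0 i xh) •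
      Measure.dirac (V + (L i).mulVec (xh - μ0g))) := by
    refine Measure.measurable_of_measurable_coe _ fun s hs => ?_
    simp only [Measure.finsetSum_apply, Measure.smul_apply, smul_eq_mul]
    refine Finset.measurable_sum _ fun i _ => ?_
    exact (hlm i).ennreal_ofReal.mul
      ((Measure.measurable_coe hs).comp (Measure.measurable_dirac.comp (measurable_aff V (L i) μ0g)))
  ext s hs
  have hkers : Measurable (fun xh => (∑ i, ENNReal.ofReal (lamWeight α μ0 S0 i xh) •
      Measure.dirac (V + (L i).mulVec (xh - μ0g))) s) := (Measure.measurable_coe hs).comp hker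
  rw [Measure.bind_apply hs hker.aemeasurable, hmix,
    lintegral_withDensity_eq_lintegral_mul _ (by fun_prop) hkers]
  have hpt : ∀ x, ((fun x => ENNReal.ofReal (∑ j, α j * gaussianPDF (μ0 j) (S0 j) x)) *
      fun xh => (∑ i, ENNReal.ofReal (lamWeight α μ0 S0 i xh) •
        Measure.dirac (V + (L i).mulVec (xh - μ0g))) s) x =
      ∑ i, ENNReal.ofReal (α i) * (((fun x => V + (L i).mulVec (x - μ0g)) ⁻¹' s).indicator
        (fun x => ENNReal.ofReal (gaussianPDF (μ0 i) (S0 i) x)) x) := by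
    intro x
    simp only [Pi.mul_apply, Measure.finsetSum_apply, Measure.smul_apply, smul_eq_mul,
      Finset.mul_sum]
    refine Finset.sum_congr rfl fun i _ => ?_
    have hnn : ∀ j ∈ Finset.univ, 0 ≤ α j * gaussianPDF (μ0 j) (S0 j) x :=
      fun j _ => (mul_pos (hα j) (pdf_pos (μ0 j) (hS0 j) x)).le
    have hpos : 0 < ∑ j, α j * gaussianPDF (μ0 j) (S0 j) x :=
      Finset.sum_pos (fun j _ => mul_pos (hα j) (pdf_pos (μ0 j) (hS0 j) x)) ⟨i, Finset.mem_univ i⟩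
    rw [← mul_assoc, ← ENNReal.ofReal_mul hpos.le]
    unfold lamWeight
    rw [mul_div_cancel₀ _ hpos.ne', ENNReal.ofReal_mul (hα i).le, mul_assoc,
      Measure.dirac_apply' _ hs]
    congr 1
    by_cases hx : V + (L i).mulVec (x - μ0g) ∈ s
    · rw [Set.indicator_of_mem hx, Set.indicator_of_mem (by exact hx)]
      simp
    · rw [Set.indicator_of_notMem hx, Set.indicator_of_notMem (by exact hx)]
      simp
  rw [lintegral_congr hpt, lintegral_finsetSum]
  · rw [Measure.finsetSum_apply]
    refine Finset.sum_congr rfl fun i _ => ?_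
    have hm := measurable_aff V (L i) μ0g hs
    rw [lintegral_const_mul _ ((hpm i).ennreal_ofReal.indicator hm), lintegral_indicator hm,
      ← withDensity_apply _ hm, ← (hν i).eq_withDensity (hS0 i), Measure.smul_apply, smul_eq_mul,
      Measure.map_apply (measurable_aff V (L i) μ0g) hs]
  · intro i _
    exact ((hpm i).ennreal_ofReal.indicator (measurable_aff V (L i) μ0g hs)).const_mul _
end

section
/- Under the setup of the probabilistic affine feedback policy, the concatenated state X = A x_0 + B U is distributed as the Gaussian mixture Σ_{i=1}^K α_i N( A μ_0^i + B V + B L^i (μ_0^i − μ_0^g), (A + B L^i) Σ_0^i (A + B L^i)^T ). -/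
open MeasureTheory Matrix

open ProbabilityTheory (gaussianReal gaussianPDFReal)

lemma std_density (n : ℕ) : Measure.pi (fun _ : Fin n => gaussianReal 0 1) =
    volume.withDensity (fun x : Fin n → ℝ => ENNReal.ofReal (∏ i, gaussianPDFReal 0 1 (x i))) := by
  refine Measure.pi_eq (fun s hs => ?_)
  have hpdf := ProbabilityTheory.integrable_gaussianPDFReal 0 1
  have hint : ∀ i : Fin n, Integrable ((s i).indicator (gaussianPDFReal 0 1)) volume :=
    fun i => hpdf.indicator (hs i)
  have hnn : ∀ i : Fin n, ∀ x, 0 ≤ (s i).indicator (gaussianPDFReal 0 1) x := fun i x =>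
    Set.indicator_nonneg (fun y _ => ProbabilityTheory.gaussianPDFReal_nonneg 0 1 y) x
  have hprod := Integrable.fintype_prod (f := fun i : Fin n => (s i).indicator (gaussianPDFReal 0 1))
    (μ := fun _ => volume) hint
  rw [withDensity_apply _ (MeasurableSet.univ_pi hs), ← lintegral_indicator (MeasurableSet.univ_pi hs)]
  have : (Set.univ.pi s).indicator
      (fun x : Fin n → ℝ => ENNReal.ofReal (∏ i, gaussianPDFReal 0 1 (x i))) =
      fun x => ENNReal.ofReal (∏ i, (s i).indicator (gaussianPDFReal 0 1) (x i)) := by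
    funext x
    by_cases hx : x ∈ Set.univ.pi s
    · rw [Set.indicator_of_mem hx]
      congr 1
      refine Finset.prod_congr rfl (fun i _ => ?_)
      rw [Set.indicator_of_mem (hx i (Set.mem_univ i))]
    · rw [Set.indicator_of_notMem hx]
      simp only [Set.mem_pi, Set.mem_univ, true_implies, not_forall] at hx
      obtain ⟨i, hi⟩ := hx
      rw [Finset.prod_eq_zero (Finset.mem_univ i) (Set.indicator_of_notMem hi _)]
      simp
  rw [this, ← ofReal_integral_eq_lintegral_ofReal (by simpa [volume_pi] using hprod)
    (Filter.Eventually.of_forall fun x => Finset.prod_nonneg fun i _ => hnn i _),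
    integral_fintype_prod_volume_eq_prod (fun i : Fin n => (s i).indicator (gaussianPDFReal 0 1)),
    ENNReal.ofReal_prod_of_nonneg (fun i _ => integral_nonneg (hnn i))]
  refine Finset.prod_congr rfl (fun i _ => ?_)
  rw [integral_indicator (hs i), ProbabilityTheory.gaussianReal_apply_eq_integral _ one_ne_zero]

lemma IsGaussian_affine {n q : ℕ} {ν : Measure (Fin n → ℝ)} {m : Fin n → ℝ}
    {S : Matrix (Fin n) (Fin n) ℝ} (h : IsGaussian ν m S) (M : Matrix (Fin q) (Fin n) ℝ)
    (b : Fin q → ℝ) :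
    IsGaussian (ν.map (fun x => M.mulVec x + b)) (M.mulVec m + b) (M * S * Mᵀ) := by
  have := h.1
  have hM : Measurable (fun x : Fin n → ℝ => M.mulVec x + b) :=
    (Continuous.add (continuous_const.matrix_mulVec continuous_id) continuous_const).measurable
  refine ⟨Measure.isProbabilityMeasure_map hM.aemeasurable, fun t => ?_⟩
  have hd : ∀ {k : ℕ} (t : Fin k → ℝ), Measurable (fun x : Fin k → ℝ => t ⬝ᵥ x) := fun t =>
    (continuous_const.dotProduct continuous_id).measurable
  have e : ∀ x, t ⬝ᵥ (M.mulVec x) = (t ᵥ* M) ⬝ᵥ x := fun x => dotProduct_mulVec t M x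
  rw [Measure.map_map (hd t) hM]
  have : (fun x => t ⬝ᵥ x) ∘ (fun x => M.mulVec x + b) =
      (fun y => y + t ⬝ᵥ b) ∘ (fun x => (t ᵥ* M) ⬝ᵥ x) := by
    funext x; simp [dotProduct_add, e]
  rw [this, ← Measure.map_map (g := fun y : ℝ => y + t ⬝ᵥ b) (measurable_id.add_const _) (hd _), h.2,
    ProbabilityTheory.gaussianReal_map_add_const]
  congr 2
  · rw [dotProduct_add, e]
  · rw [← mulVec_mulVec, ← mulVec_mulVec, e, mulVec_transpose]

lemma std_unique {n : ℕ} {ν : Measure (Fin n → ℝ)} (h : IsGaussian ν 0 1) :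
    ν = Measure.pi (fun _ : Fin n => gaussianReal 0 1) := by
  have := h.1
  refine charFunDual_eq_pi_iff.1 (fun L => ?_)
  set t : Fin n → ℝ := fun i => L (Pi.single i 1) with ht
  have hL : (L : (Fin n → ℝ) → ℝ) = fun x => t ⬝ᵥ x := by
    funext x
    have := LinearMap.pi_apply_eq_sum_univ (L : (Fin n → ℝ) →ₗ[ℝ] ℝ) x
    simp only [ContinuousLinearMap.coe_coe] at this
    rw [this]
    simp only [dotProduct, ht, smul_eq_mul]
    refine Finset.sum_congr rfl (fun i _ => ?_)
    rw [mul_comm]; congr 2; funext j; simp [Pi.single_apply, eq_comm]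
  have hi : ∀ i, ((L.comp (ContinuousLinearMap.single ℝ (fun _ : Fin n => ℝ) i) : ℝ →L[ℝ] ℝ) : ℝ → ℝ) =
      fun x => t i * x := by
    intro i; funext x
    simp [hL, dotProduct, Pi.single_apply]
  rw [charFunDual_eq_charFun_map_one, hL, h.2]
  simp_rw [charFunDual_eq_charFun_map_one, hi, ProbabilityTheory.gaussianReal_map_const_mul,
    ProbabilityTheory.charFun_gaussianReal]
  rw [← Complex.exp_sum]
  have : 0 ≤ t ⬝ᵥ t := by simpa using dotProduct_star_self_nonneg t
  congr 1
  simp [Real.coe_toNNReal _ this]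
  simp [dotProduct, Finset.sum_div, pow_two]

lemma gaussian_density {n : ℕ} {ν : Measure (Fin n → ℝ)} {m : Fin n → ℝ}
    {S : Matrix (Fin n) (Fin n) ℝ} (hS : S.PosDef) (h : IsGaussian ν m S) :
    ν = volume.withDensity (fun x => ENNReal.ofReal (gaussianPDF m S x)) := by
  obtain ⟨C, hC⟩ : ∃ C : Matrix (Fin n) (Fin n) ℝ, S = Cᵀ * C := by
    open scoped MatrixOrder in
    obtain ⟨C, hC⟩ := CStarAlgebra.nonneg_iff_eq_star_mul_self.mp hS.posSemidef.nonneg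
    exact ⟨C, by simpa [star_eq_conjTranspose] using hC⟩
  have hdet : S.det = C.det ^ 2 := by rw [hC, det_mul, det_transpose, pow_two]
  have hC0 : C.det ≠ 0 := by
    intro h0; have := hS.det_pos; rw [hdet, h0] at this; simp at this
  set R := Cᵀ with hR
  have hR0 : R.det ≠ 0 := by rwa [hR, det_transpose]
  have hRu : IsUnit R.det := hR0.isUnit
  have hCu : IsUnit C.det := hC0.isUnit
  have h1 := IsGaussian_affine h R⁻¹ (-(R⁻¹.mulVec m))
  have e1 : R⁻¹ * S * (R⁻¹)ᵀ = 1 := by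
    rw [hC, transpose_nonsing_inv, hR, transpose_transpose, ← hR, nonsing_inv_mul_cancel_left _ _ hRu,
      mul_nonsing_inv _ hCu]
  rw [e1, add_neg_cancel] at h1
  have h2 := std_unique h1
  rw [std_density] at h2
  have m1 : Measurable (fun x : Fin n → ℝ => R⁻¹.mulVec x + -(R⁻¹.mulVec m)) :=
    (Continuous.add (continuous_const.matrix_mulVec continuous_id) continuous_const).measurable
  have mR : Measurable (fun x : Fin n → ℝ => R.mulVec x) :=
    (continuous_const.matrix_mulVec continuous_id).measurable
  have m2 : Measurable (fun x : Fin n → ℝ => R.mulVec x + m) := mR.add_const m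
  have h3 := congrArg (Measure.map (fun x : Fin n → ℝ => R.mulVec x + m)) h2
  rw [Measure.map_map m2 m1] at h3
  have e2 : (fun x : Fin n → ℝ => R.mulVec x + m) ∘
      (fun x : Fin n → ℝ => R⁻¹.mulVec x + -(R⁻¹.mulVec m)) = id := by
    funext x
    simp [mulVec_add, mulVec_neg, mulVec_mulVec, mul_nonsing_inv _ hRu]
  rw [e2, Measure.map_id] at h3
  rw [h3]
  have hg : Measurable (fun x => ENNReal.ofReal (gaussianPDF m S x)) := by
    refine ENNReal.measurable_ofReal.comp (Continuous.measurable ?_)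
    unfold gaussianPDF
    refine continuous_const.mul (Real.continuous_exp.comp (continuous_const.mul ?_))
    exact (continuous_id.sub continuous_const).dotProduct
      (continuous_const.matrix_mulVec (continuous_id.sub continuous_const))
  have hvol : (volume : Measure (Fin n → ℝ)).map (fun x => R.mulVec x + m) =
      ENNReal.ofReal |(R.det)⁻¹| • volume := by
    have : (fun x : Fin n → ℝ => R.mulVec x + m) = (fun x => x + m) ∘ (toLin' R) := by
      funext x; simp
    rw [this, ← Measure.map_map (g := fun x : Fin n → ℝ => x + m) (f := toLin' R) (measurable_id.add_const m) mR,
      Real.map_matrix_volume_pi_eq_smul_volume_pi hR0, Measure.map_smul, map_add_right_eq_self]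
  have hpt : ∀ y : Fin n → ℝ, ENNReal.ofReal (∏ i, gaussianPDFReal 0 1 (y i)) =
      ENNReal.ofReal |R.det| * ENNReal.ofReal (gaussianPDF m S (R.mulVec y + m)) := by
    intro y
    rw [← ENNReal.ofReal_mul (abs_nonneg _)]
    congr 1
    have q : (R *ᵥ y) ⬝ᵥ S⁻¹ *ᵥ (R *ᵥ y) = y ⬝ᵥ y := by
      have : S⁻¹ = C⁻¹ * R⁻¹ := by rw [hC, Matrix.mul_inv_rev]
      rw [this, mulVec_mulVec, Matrix.mul_assoc, nonsing_inv_mul _ hRu, Matrix.mul_one, hR,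
        mulVec_transpose, ← dotProduct_mulVec, mulVec_mulVec, mul_nonsing_inv _ hCu, one_mulVec]
    have s : √((2 * Real.pi) ^ n * S.det) = √((2 * Real.pi)) ^ n * |R.det| := by
      rw [Real.sqrt_mul (by positivity), hdet, Real.sqrt_sq_eq_abs, hR, det_transpose]
      congr 1
      rw [Real.sqrt_eq_iff_mul_self_eq (by positivity) (by positivity), ← mul_pow,
        Real.mul_self_sqrt (by positivity)]
    unfold gaussianPDF
    rw [add_sub_cancel_right, q, s]
    simp only [ProbabilityTheory.gaussianPDFReal, Finset.prod_mul_distrib, ← Real.exp_sum]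
    have : |R.det| ≠ 0 := abs_ne_zero.2 hR0
    simp [dotProduct, Finset.mul_sum]
    field_simp
    simp only [Finset.sum_neg_distrib]
    rw [mul_right_comm, ← mul_pow]
    have h2 : √2 ≠ 0 := by positivity
    have hp : √Real.pi ≠ 0 := by positivity
    have : (√2)⁻¹ * (√Real.pi)⁻¹ * (√Real.pi * √2) = 1 := by field_simp
    simp [this]
  have habs : ENNReal.ofReal |R.det| * ENNReal.ofReal |(R.det)⁻¹| = 1 := by
    rw [← ENNReal.ofReal_mul (abs_nonneg _), ← abs_mul, mul_inv_cancel₀ hR0]; simp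
  ext s hs
  rw [Measure.map_apply m2 hs, withDensity_apply _ (m2 hs), withDensity_apply _ hs]
  simp_rw [hpt]
  rw [lintegral_const_mul _ (show Measurable (fun x => ENNReal.ofReal (gaussianPDF m S (R.mulVec x + m)))
    from hg.comp m2), ← setLIntegral_map hs hg m2, hvol, Measure.restrict_smul,
    lintegral_smul_measure, smul_eq_mul, ← mul_assoc, habs, one_mul]

/-- Under the probabilistic affine policy, the concatenated state `X = A x₀ + B U` is
distributed as the Gaussian mixture
`∑ᵢ αᵢ N(A μ₀ⁱ + B V + B Lⁱ(μ₀ⁱ − μ₀ᵍ), (A + B Lⁱ) Σ₀ⁱ (A + B Lⁱ)ᵀ)`. -/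
theorem concatenated_state_distribution {n m q K : ℕ}
    (α : Fin K → ℝ) (hα : ∀ i, 0 < α i) (hαsum : ∑ i, α i = 1)
    (μ0 : Fin K → (Fin n → ℝ)) (S0 : Fin K → Matrix (Fin n) (Fin n) ℝ)
    (hS0 : ∀ i, (S0 i).PosDef)
    (ν : Fin K → Measure (Fin n → ℝ))
    (hν : ∀ i, IsGaussian (ν i) (μ0 i) (S0 i))
    (A : Matrix (Fin q) (Fin n) ℝ) (B : Matrix (Fin q) (Fin m) ℝ)
    (V : Fin m → ℝ) (L : Fin K → Matrix (Fin m) (Fin n) ℝ)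
    (μ0g : Fin n → ℝ) (hμ0g : μ0g = ∑ i, α i • μ0 i) :
    ∃ ρ : Fin K → Measure (Fin q → ℝ),
      (∀ i, IsGaussian (ρ i)
        (A.mulVec (μ0 i) + B.mulVec V + (B * L i).mulVec (μ0 i - μ0g))
        ((A + B * L i) * S0 i * (A + B * L i)ᵀ)) ∧
      (∑ i, ENNReal.ofReal (α i) • ν i).bind
          (fun xh => ∑ i, ENNReal.ofReal (lamWeight α μ0 S0 i xh) •
            Measure.dirac (A.mulVec xh + B.mulVec (V + (L i).mulVec (xh - μ0g)))) =
        ∑ i, ENNReal.ofReal (α i) • ρ i := by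
  have hT : ∀ i (x : Fin n → ℝ), A.mulVec x + B.mulVec (V + (L i).mulVec (x - μ0g)) =
      (A + B * L i).mulVec x + (B.mulVec V - (B * L i).mulVec μ0g) := by
    intro i x
    simp only [mulVec_add, mulVec_sub, add_mulVec, mulVec_mulVec]
    abel
  have hTm : ∀ i, Measurable (fun x : Fin n → ℝ =>
      A.mulVec x + B.mulVec (V + (L i).mulVec (x - μ0g))) := by
    intro i
    simp_rw [hT]
    exact (Continuous.add (continuous_const.matrix_mulVec continuous_id) continuous_const).measurable
  have hg : ∀ i, Measurable (gaussianPDF (μ0 i) (S0 i)) := by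
    intro i
    refine Continuous.measurable ?_
    unfold gaussianPDF
    refine continuous_const.mul (Real.continuous_exp.comp (continuous_const.mul ?_))
    exact (continuous_id.sub continuous_const).dotProduct
      (continuous_const.matrix_mulVec (continuous_id.sub continuous_const))
  have hgpos : ∀ i x, 0 < gaussianPDF (μ0 i) (S0 i) x := by
    intro i x
    have := (hS0 i).det_pos
    unfold gaussianPDF
    positivity
  have hlm : ∀ i, Measurable (lamWeight α μ0 S0 i) := by
    intro i
    unfold lamWeight
    exact ((hg i).const_mul _).div (Finset.measurable_sum _ fun j _ => (hg j).const_mul _)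
  have hne : (Finset.univ : Finset (Fin K)).Nonempty := by
    by_contra h0
    rw [Finset.not_nonempty_iff_eq_empty] at h0
    rw [h0] at hαsum
    simp at hαsum
  set F : (Fin n → ℝ) → ℝ := fun x => ∑ j, α j * gaussianPDF (μ0 j) (S0 j) x with hF
  have hFpos : ∀ x, 0 < F x := fun x => Finset.sum_pos (fun j _ => mul_pos (hα j) (hgpos j x)) hne
  have hFm : Measurable F := Finset.measurable_sum _ fun j _ => (hg j).const_mul _
  have hd := fun i => gaussian_density (hS0 i) (hν i)
  have hαd : ∀ i, ENNReal.ofReal (α i) • ν i = volume.withDensity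
      (fun x => ENNReal.ofReal (α i * gaussianPDF (μ0 i) (S0 i) x)) := by
    intro i
    rw [hd i, ← withDensity_smul _ (hg i).ennreal_ofReal]
    congr 1
    funext x
    simp [ENNReal.ofReal_mul (hα i).le]
  have hmix : ∑ i, ENNReal.ofReal (α i) • ν i =
      volume.withDensity (fun x => ENNReal.ofReal (F x)) := by
    ext s hs
    rw [withDensity_apply _ hs, Measure.finsetSum_apply]
    simp_rw [hαd, withDensity_apply _ hs, hF]
    rw [← lintegral_finsetSum _ (fun i _ => ((hg i).const_mul _).ennreal_ofReal)]
    congr 1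
    funext x
    rw [ENNReal.ofReal_sum_of_nonneg (fun i _ => (mul_pos (hα i) (hgpos i x)).le)]
  refine ⟨fun i => (ν i).map (fun x => A.mulVec x + B.mulVec (V + (L i).mulVec (x - μ0g))),
    fun i => ?_, ?_⟩
  · have := IsGaussian_affine (hν i) (A + B * L i) (B.mulVec V - (B * L i).mulVec μ0g)
    simp_rw [hT]
    convert this using 1
    rw [add_mulVec, mulVec_sub]; abel
  · have hk : Measurable (fun xh : Fin n → ℝ => ∑ i, ENNReal.ofReal (lamWeight α μ0 S0 i xh) •
            Measure.dirac (A.mulVec xh + B.mulVec (V + (L i).mulVec (xh - μ0g)))) := by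
      refine Measure.measurable_of_measurable_coe _ (fun s hs => ?_)
      simp only [Measure.finsetSum_apply, Measure.smul_apply, smul_eq_mul]
      refine Finset.measurable_sum _ (fun i _ => (hlm i).ennreal_ofReal.mul ?_)
      exact (Measure.measurable_coe hs).comp (Measure.measurable_dirac.comp (hTm i))
    ext s hs
    have hks := (Measure.measurable_coe hs).comp hk
    simp only [Function.comp_def] at hks
    rw [Measure.bind_apply hs hk.aemeasurable, hmix,
      lintegral_withDensity_eq_lintegral_mul _ hFm.ennreal_ofReal hks, Measure.finsetSum_apply]
    have hr : ∀ i, (ENNReal.ofReal (α i) • (ν i).map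
        (fun x => A.mulVec x + B.mulVec (V + (L i).mulVec (x - μ0g)))) s =
        ∫⁻ x, ENNReal.ofReal (α i * gaussianPDF (μ0 i) (S0 i) x) *
          Measure.dirac (A.mulVec x + B.mulVec (V + (L i).mulVec (x - μ0g))) s := by
      intro i
      rw [← Measure.map_smul, Measure.map_apply (hTm i) hs, hαd, withDensity_apply _ (hTm i hs),
        ← lintegral_indicator (hTm i hs)]
      congr 1
      funext x
      rw [Measure.dirac_apply' _ hs]
      by_cases hx : A.mulVec x + B.mulVec (V + (L i).mulVec (x - μ0g)) ∈ s
      · simp [Set.indicator, hx]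
      · simp [Set.indicator, hx]
    simp_rw [hr]
    have hm : ∀ i, Measurable (fun x => ENNReal.ofReal (α i * gaussianPDF (μ0 i) (S0 i) x) *
          Measure.dirac (A.mulVec x + B.mulVec (V + (L i).mulVec (x - μ0g))) s) := fun i =>
      ((hg i).const_mul _).ennreal_ofReal.mul
        ((Measure.measurable_coe hs).comp (Measure.measurable_dirac.comp (hTm i)))
    rw [← lintegral_finsetSum _ (fun i _ => hm i)]
    congr 1
    funext x
    simp only [Pi.mul_apply, Measure.finsetSum_apply, Measure.smul_apply, smul_eq_mul,
      Finset.mul_sum]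
    refine Finset.sum_congr rfl (fun i _ => ?_)
    rw [← mul_assoc, ← ENNReal.ofReal_mul (hFpos x).le]
    congr 2
    unfold lamWeight
    exact mul_div_cancel₀ _ (hFpos x).ne'
end
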